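/- Let Y and E be normed spaces, X a convex subset of Y, L : D(L) → F(X;E) a linear operator dominated by a positive linear operator S : D(S) → F(X;ℝ), where UCB(X;E) ⊆ D(L), UCB(X;ℝ) ⊆ D(S) and ψ_t² ∈ D(S) for every t ∈ Y. If moreover L preserves the constants, i.e. every constant mapping c belongs to D(L) and L(c)(t) = c for all c ∈ E and t ∈ X, then for every F ∈ UCB(X;E), every t ∈ X and every δ > 0 one has ‖L(F)(t) − F(t)‖ ≤ ω(F,δ)·[S(𝟙)(t) + δ⁻²·S(ψ_t²)(t)]. -/

import Mathlib

open Filter Topology Bornology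

/-- The modulus of continuity of `F` on `X`:
`ω(F,h) = sup {‖F u − F t‖ : t, u ∈ X, ‖t − u‖ ≤ h}`. -/
noncomputable def modulusOfContinuity {Y E : Type*} [NormedAddCommGroup Y]
    [NormedAddCommGroup E] (X : Set Y) (F : Y → E) (h : ℝ) : ℝ :=
  sSup {r : ℝ | ∃ t ∈ X, ∃ u ∈ X, ‖t - u‖ ≤ h ∧ r = ‖F u - F t‖}

theorem norm_sub_le_modulusOfContinuity {Y E : Type*} [NormedAddCommGroup Y]
    [NormedAddCommGroup E] {X : Set Y} {F : Y → E} (hF : IsBounded (F '' X)) {h : ℝ}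
    {t u : Y} (ht : t ∈ X) (hu : u ∈ X) (htu : ‖t - u‖ ≤ h) :
    ‖F u - F t‖ ≤ modulusOfContinuity X F h := by
  obtain ⟨C, hC⟩ := Metric.isBounded_iff.mp hF
  refine le_csSup ⟨C, ?_⟩ ⟨t, ht, u, hu, htu, rfl⟩
  rintro r ⟨a, ha, b, hb, -, rfl⟩
  rw [← dist_eq_norm]
  exact hC (Set.mem_image_of_mem F hb) (Set.mem_image_of_mem F ha)

theorem norm_sub_le_nat_mul_modulusOfContinuity {Y E : Type*} [NormedAddCommGroup Y]
    [NormedSpace ℝ Y] [NormedAddCommGroup E] {X : Set Y} (hX : Convex ℝ X) {F : Y → E}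
    (hF : IsBounded (F '' X)) {h : ℝ} {t : Y} (ht : t ∈ X) (n : ℕ) {u : Y} (hu : u ∈ X)
    (htu : ‖u - t‖ ≤ n * h) :
    ‖F u - F t‖ ≤ n * modulusOfContinuity X F h := by
  induction n generalizing u with
  | zero =>
    obtain rfl : u = t := by simpa [sub_eq_zero] using htu
    simp
  | succ n ih =>
    have hn : (0 : ℝ) < n + 1 := by positivity
    push_cast at htu ⊢
    set v : Y := t + ((n : ℝ) / (n + 1)) • (u - t) with hv
    have hvX : v ∈ X := hX.add_smul_sub_mem ht hu
      ⟨by positivity, (div_le_one hn).mpr (by linarith)⟩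
    have hvt : ‖v - t‖ ≤ n * h := by
      rw [hv, add_sub_cancel_left, norm_smul, Real.norm_of_nonneg (by positivity)]
      calc (n : ℝ) / (n + 1) * ‖u - t‖ ≤ n / (n + 1) * ((n + 1) * h) := by gcongr
        _ = n * h := by field_simp
    have hvu : ‖v - u‖ ≤ h := by
      have hsub : v - u = -((1 / ((n : ℝ) + 1)) • (u - t)) := by
        have hc : (n : ℝ) / (n + 1) = 1 - 1 / (n + 1) := by field_simp; ring
        rw [hv, hc]
        module
      rw [hsub, norm_neg, norm_smul, Real.norm_of_nonneg (by positivity)]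
      calc 1 / ((n : ℝ) + 1) * ‖u - t‖ ≤ 1 / (n + 1) * ((n + 1) * h) := by gcongr
        _ = h := by field_simp
    calc ‖F u - F t‖ ≤ ‖F u - F v‖ + ‖F v - F t‖ := norm_sub_le_norm_sub_add_norm_sub _ _ _
      _ ≤ modulusOfContinuity X F h + n * modulusOfContinuity X F h :=
        add_le_add (norm_sub_le_modulusOfContinuity hF hvX hu hvu) (ih hvX hvt)
      _ = (n + 1) * modulusOfContinuity X F h := by ring

theorem norm_sub_le_modulusOfContinuity_mul_one_add_sq {Y E : Type*} [NormedAddCommGroup Y]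
    [NormedSpace ℝ Y] [NormedAddCommGroup E] {X : Set Y} (hX : Convex ℝ X) {F : Y → E}
    (hF : IsBounded (F '' X)) {δ : ℝ} (hδ : 0 < δ) {t u : Y} (ht : t ∈ X) (hu : u ∈ X) :
    ‖F u - F t‖ ≤ modulusOfContinuity X F δ * (1 + (δ ^ 2)⁻¹ * ‖u - t‖ ^ 2) := by
  have hω : 0 ≤ modulusOfContinuity X F δ := by
    simpa using norm_sub_le_modulusOfContinuity hF ht ht (by simpa using hδ.le)
  have hsq : (δ ^ 2)⁻¹ * ‖u - t‖ ^ 2 = (‖u - t‖ / δ) ^ 2 := by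
    rw [div_pow, div_eq_inv_mul]
  rw [hsq, mul_comm]
  obtain hd | hd := le_total ‖u - t‖ δ
  · have := norm_sub_le_modulusOfContinuity hF ht hu ((norm_sub_rev t u).trans_le hd)
    nlinarith [mul_nonneg hω (sq_nonneg (‖u - t‖ / δ))]
  · have h1 : 1 ≤ ‖u - t‖ / δ := (one_le_div hδ).mpr hd
    refine (norm_sub_le_nat_mul_modulusOfContinuity hX hF ht ⌈‖u - t‖ / δ⌉₊ hu
      ((div_le_iff₀ hδ).mp (Nat.le_ceil _))).trans ?_
    gcongr
    nlinarith [Nat.ceil_lt_add_one (zero_le_one.trans h1)]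

theorem stmt_1
    {Y : Type*} [NormedAddCommGroup Y] [NormedSpace ℝ Y]
    {E : Type*} [NormedAddCommGroup E] [NormedSpace ℝ E]
    (X : Set Y) (hXconv : Convex ℝ X)
    (DL : Submodule ℝ (Y → E)) (DS : Submodule ℝ (Y → ℝ))
    (L : DL →ₗ[ℝ] (Y → E)) (S : DS →ₗ[ℝ] (Y → ℝ))
    -- S is positive
    (hSpos : ∀ f : DS, (∀ u ∈ X, 0 ≤ f.1 u) → ∀ t ∈ X, 0 ≤ S f t)
    -- L is dominated by S
    (hdom_mem : ∀ F : DL, (fun u => ‖F.1 u‖) ∈ DS)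
    (hdom : ∀ F : DL, ∀ t ∈ X, ‖L F t‖ ≤ S ⟨fun u => ‖F.1 u‖, hdom_mem F⟩ t)
    -- UCB(X;E) ⊆ D(L) and UCB(X;ℝ) ⊆ D(S)
    (hDL : ∀ F : Y → E, UniformContinuousOn F X → IsBounded (F '' X) → F ∈ DL)
    (hDS : ∀ f : Y → ℝ, UniformContinuousOn f X → IsBounded (f '' X) → f ∈ DS)
    -- ψ_t² ∈ D(S) for every t ∈ Y
    (hpsi : ∀ t : Y, (fun u => ‖u - t‖ ^ 2) ∈ DS)
    -- L preserves the constants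
    (hconst_mem : ∀ c : E, (fun _ : Y => c) ∈ DL)
    (hconst : ∀ c : E, ∀ t ∈ X, L ⟨fun _ => c, hconst_mem c⟩ t = c) :
    ∀ F : Y → E, UniformContinuousOn F X → IsBounded (F '' X) →
      ∀ t ∈ X, ∀ δ : ℝ, 0 < δ →
      ∀ (hF : F ∈ DL) (h1 : (fun _ : Y => (1 : ℝ)) ∈ DS),
      ‖L ⟨F, hF⟩ t - F t‖ ≤
        modulusOfContinuity X F δ *
          (S ⟨fun _ => 1, h1⟩ t + (δ ^ 2)⁻¹ * S ⟨fun u => ‖u - t‖ ^ 2, hpsi t⟩ t) := by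
  intro F _ hFb t ht δ hδ hF h1
  set ω := modulusOfContinuity X F δ
  let G : DL := ⟨F, hF⟩ - ⟨fun _ => F t, hconst_mem (F t)⟩
  let N : DS := ⟨fun u => ‖G.1 u‖, hdom_mem G⟩
  let B : DS := ω • (⟨fun _ => 1, h1⟩ + (δ ^ 2)⁻¹ • ⟨fun u => ‖u - t‖ ^ 2, hpsi t⟩)
  have hLG : L G t = L ⟨F, hF⟩ t - F t := by
    rw [map_sub, Pi.sub_apply, hconst _ t ht]
  have hSB : S B t =
      ω * (S ⟨fun _ => 1, h1⟩ t + (δ ^ 2)⁻¹ * S ⟨fun u => ‖u - t‖ ^ 2, hpsi t⟩ t) := by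
    simp only [B, map_smul, map_add, Pi.smul_apply, Pi.add_apply, smul_eq_mul]
  have hNB : 0 ≤ S (B - N) t := by
    refine hSpos _ (fun u hu => sub_nonneg.mpr ?_) t ht
    exact norm_sub_le_modulusOfContinuity_mul_one_add_sq hXconv hFb hδ ht hu
  rw [map_sub, Pi.sub_apply, sub_nonneg] at hNB
  rw [← hLG, ← hSB]
  exact (hdom G t ht).trans hNB
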